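/- Assume 𝔇 < 0 (hence ξ > 0). For T ∈ (0, T_esc), let h(t) := −(√(−𝔇)/‖b‖²)·tan( arctan(−(a·b)/√(−𝔇)) − t√(−𝔇) ) − (a·b)/‖b‖² and g(t) := (‖b‖²/2)·∫₀ᵗ h(s) ds. Then for every z > 0, exp( g(T) + (1/2)·h(T)·z² ) → +∞ as T → T_esc from the left. -/

import Mathlib

open Matrix Real Set Filter

/-- Euclidean inner product on `ℝ²`. -/
noncomputable def dot2 (a b : Fin 2 → ℝ) : ℝ := a 0 * b 0 + a 1 * b 1

/-- Euclidean norm on `ℝ²`. -/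
noncomputable def nrm2 (a : Fin 2 → ℝ) : ℝ := Real.sqrt (dot2 a a)

/-- Hyperbolic cotangent. -/
noncomputable def coth (x : ℝ) : ℝ := Real.cosh x / Real.sinh x

/-- when `𝔇 < 0`, for every `z > 0` the quantity
`exp(g(T) + ½ h(T) z²)` blows up to `+∞` as `T → T_esc⁻`. -/
theorem stmt_13 (a b : Fin 2 → ℝ) (ξ : ℝ) (hab : dot2 a b < 0) (hξ : ξ ≠ 0)
    (D : ℝ) (hD : D = (dot2 a b) ^ 2 - ξ * (nrm2 a) ^ 2 * (nrm2 b) ^ 2) (hDneg : D < 0)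
    (Tesc : ℝ)
    (hTesc : Tesc = (1 / Real.sqrt (-D)) *
      (π / 2 + Real.arctan (-(dot2 a b) / Real.sqrt (-D))))
    (h : ℝ → ℝ)
    (hh : ∀ t : ℝ, h t =
      -(Real.sqrt (-D) / (nrm2 b) ^ 2) *
        Real.tan (Real.arctan (-(dot2 a b) / Real.sqrt (-D)) - t * Real.sqrt (-D))
      - dot2 a b / (nrm2 b) ^ 2)
    (g : ℝ → ℝ) (hg : ∀ t : ℝ, g t = ((nrm2 b) ^ 2 / 2) * ∫ s in (0 : ℝ)..t, h s) :
    ∀ z : ℝ, 0 < z →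
      Filter.Tendsto (fun T => Real.exp (g T + (1 / 2) * h T * z ^ 2))
        (nhdsWithin Tesc (Set.Ioo 0 Tesc)) Filter.atTop := by
  intro z hz
  have hs : 0 < Real.sqrt (-D) := Real.sqrt_pos.mpr (by linarith)
  set s := Real.sqrt (-D) with hsdef
  set c := -(dot2 a b) / s with hc
  have hn : 0 < (nrm2 b) ^ 2 := by
    have hbb : 0 ≤ dot2 b b := by unfold dot2; nlinarith [sq_nonneg (b 0), sq_nonneg (b 1)]
    have e : (nrm2 b) ^ 2 = dot2 b b := by unfold nrm2; exact Real.sq_sqrt hbb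
    rw [e]
    rcases hbb.lt_or_eq with h1 | h1
    · exact h1
    · exfalso
      unfold dot2 at h1 hab
      have h0 : b 0 = 0 := by nlinarith [sq_nonneg (b 0), sq_nonneg (b 1)]
      have h2 : b 1 = 0 := by nlinarith [sq_nonneg (b 0), sq_nonneg (b 1)]
      rw [h0, h2] at hab
      simp at hab
  set n := (nrm2 b) ^ 2 with hndef
  have hTs : Tesc * s = π / 2 + Real.arctan c := by
    rw [hTesc]; field_simp
  have hscd : s * c = -(dot2 a b) := by rw [hc]; field_simp
  have hlow : ∀ t, t < Tesc → -(π / 2) < Real.arctan c - t * s := by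
    intro t ht
    nlinarith [mul_lt_mul_of_pos_right ht hs]
  have hnonneg : ∀ t, 0 ≤ t → t < Tesc → 0 ≤ h t := by
    intro t h0 h1
    have hle : Real.arctan c - t * s ≤ Real.arctan c := by nlinarith [mul_nonneg h0 hs.le]
    have htan : Real.tan (Real.arctan c - t * s) ≤ c := by
      have := Real.strictMonoOn_tan.monotoneOn
        (⟨hlow t h1, lt_of_le_of_lt hle (Real.arctan_lt_pi_div_two c)⟩)
        (⟨Real.neg_pi_div_two_lt_arctan c, Real.arctan_lt_pi_div_two c⟩) hle
      rwa [Real.tan_arctan] at this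
    have e : h t = s * (c - Real.tan (Real.arctan c - t * s)) / n := by
      rw [hh t, mul_sub, hscd]; ring
    rw [e]
    exact div_nonneg (mul_nonneg hs.le (sub_nonneg.mpr htan)) hn.le
  have hgnn : ∀ T ∈ Set.Ioo 0 Tesc, 0 ≤ g T := by
    intro T hT
    rw [hg T]
    refine mul_nonneg (by positivity) (intervalIntegral.integral_nonneg hT.1.le ?_)
    intro u hu
    exact hnonneg u hu.1 (lt_of_le_of_lt hu.2 hT.2)
  have hθ : Filter.Tendsto (fun T => Real.arctan c - T * s) (nhdsWithin Tesc (Set.Ioo 0 Tesc))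
      (nhdsWithin (-(π / 2)) (Set.Ioi (-(π / 2)))) := by
    refine tendsto_nhdsWithin_iff.mpr ⟨?_, ?_⟩
    · have hcont : Continuous (fun T : ℝ => Real.arctan c - T * s) := by fun_prop
      have := hcont.tendsto Tesc
      have e : Real.arctan c - Tesc * s = -(π / 2) := by rw [hTs]; ring
      simp only [e] at this
      exact this.mono_left nhdsWithin_le_nhds
    · filter_upwards [self_mem_nhdsWithin] with T hT
      exact hlow T hT.2
  have htan := Real.tendsto_tan_neg_pi_div_two.comp hθ
  have hh' : Filter.Tendsto h (nhdsWithin Tesc (Set.Ioo 0 Tesc)) Filter.atTop := by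
    have h1 := (htan.const_mul_atBot_of_neg (r := -(s / n)) (by
      have := div_pos hs hn
      linarith))
    have h2 := Filter.tendsto_atTop_add_const_right _ (-(dot2 a b / n)) h1
    refine h2.congr ?_
    intro T
    rw [hh T]
    simp [sub_eq_add_neg]
  refine Real.tendsto_exp_atTop.comp ?_
  have h3 := hh'.const_mul_atTop (r := z ^ 2 / 2) (by positivity)
  refine Filter.tendsto_atTop_mono' _ ?_ h3
  filter_upwards [self_mem_nhdsWithin] with T hT
  have := hgnn T hT
  nlinarith
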